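/- The restriction of Ψ₁ to ∂D is a homeomorphism from ∂D onto ∂D; that is, Ψ₁ restricted to ∂D is continuous and is a bijection of ∂D onto itself (and hence, ∂D being compact Hausdorff, a homeomorphism). -/

import Mathlib

/-- The circle `∂𝔻` in the plane `H = {x₁ + x₂ + x₃ = 1}` in `ℝ³`. -/
def sphereD : Set (ℝ × ℝ × ℝ) :=
  {p | p.1 + p.2.1 + p.2.2 = 1 ∧
    (p.1 - 1/3)^2 + (p.2.1 - 1/3)^2 + (p.2.2 - 1/3)^2 = 8/75}

/-- The map `Ψ₁(x) = (1/(15x₁))·(10x₁, 4x₁+3x₂, 4x₁+3x₃) − (1/(25x₁))·(1,2,2)`. -/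
noncomputable def Ψ₁ (p : ℝ × ℝ × ℝ) : ℝ × ℝ × ℝ :=
  ((10 * p.1) / (15 * p.1) - 1 / (25 * p.1),
   (4 * p.1 + 3 * p.2.1) / (15 * p.1) - 2 / (25 * p.1),
   (4 * p.1 + 3 * p.2.2) / (15 * p.1) - 2 / (25 * p.1))

/-- The inverse of `Ψ₁` on `∂𝔻`. -/
noncomputable def Ψ₁Inv (p : ℝ × ℝ × ℝ) : ℝ × ℝ × ℝ :=
  (3 / (50 - 75 * p.1),
   (15 * p.2.1 - 4) / (50 - 75 * p.1) + 2 / 5,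
   (15 * p.2.2 - 4) / (50 - 75 * p.1) + 2 / 5)

lemma mem_sphereD_iff {a b c : ℝ} :
    (a, b, c) ∈ sphereD ↔ a + b + c = 1 ∧ (b - c) ^ 2 = 3 * (3 / 5 - a) * (a - 1 / 15) := by
  simp only [sphereD, Set.mem_ofPred_eq]
  refine and_congr_right fun h => ?_
  obtain rfl : a = 1 - b - c := by linarith
  constructor <;> intro h <;> linarith

lemma fst_mem_Icc_of_mem_sphereD {p : ℝ × ℝ × ℝ} (hp : p ∈ sphereD) :
    p.1 ∈ Set.Icc (1 / 15 : ℝ) (3 / 5) := by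
  obtain ⟨a, b, c⟩ := p
  obtain ⟨-, h⟩ := mem_sphereD_iff.1 hp
  constructor <;> nlinarith [sq_nonneg (b - c)]

lemma fst_ne_zero_of_mem_sphereD {p : ℝ × ℝ × ℝ} (hp : p ∈ sphereD) : p.1 ≠ 0 := by
  have := (fst_mem_Icc_of_mem_sphereD hp).1
  exact ne_of_gt (by linarith)

lemma denom_ne_zero_of_mem_sphereD {p : ℝ × ℝ × ℝ} (hp : p ∈ sphereD) :
    50 - 75 * p.1 ≠ 0 := by
  have := (fst_mem_Icc_of_mem_sphereD hp).2
  exact ne_of_gt (by linarith)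

lemma mapsTo_Ψ₁ : Set.MapsTo Ψ₁ sphereD sphereD := by
  rintro ⟨a, b, c⟩ hp
  have ha : a ≠ 0 := fst_ne_zero_of_mem_sphereD hp
  obtain ⟨h, hq⟩ := mem_sphereD_iff.1 hp
  refine mem_sphereD_iff.2 ⟨?_, ?_⟩
  · obtain rfl : c = 1 - a - b := by linarith
    field_simp
    ring
  · dsimp only
    have hd : (4 * a + 3 * b) / (15 * a) - 2 / (25 * a) -
        ((4 * a + 3 * c) / (15 * a) - 2 / (25 * a)) = (b - c) / (5 * a) := by
      field_simp
      ring
    rw [hd, div_pow, hq]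
    field_simp
    ring

lemma mapsTo_Ψ₁Inv : Set.MapsTo Ψ₁Inv sphereD sphereD := by
  rintro ⟨a, b, c⟩ hp
  have ha : 50 - 75 * a ≠ 0 := denom_ne_zero_of_mem_sphereD hp
  obtain ⟨h, hq⟩ := mem_sphereD_iff.1 hp
  refine mem_sphereD_iff.2 ⟨?_, ?_⟩
  · obtain rfl : c = 1 - a - b := by linarith
    dsimp only
    rw [← sub_eq_zero]
    field_simp
    ring
  · dsimp only
    have hd : (15 * b - 4) / (50 - 75 * a) + 2 / 5 - ((15 * c - 4) / (50 - 75 * a) + 2 / 5) =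
        15 * (b - c) / (50 - 75 * a) := by
      ring
    rw [hd, div_pow, mul_pow, hq]
    obtain ⟨d, rfl⟩ : ∃ d, a = (50 - d) / 75 := ⟨50 - 75 * a, by ring⟩
    have hden : 50 - 75 * ((50 - d) / 75) = d := by ring
    rw [hden] at ha ⊢
    field_simp
    ring

lemma invOn_Ψ₁Inv : Set.InvOn Ψ₁Inv Ψ₁ sphereD sphereD := by
  constructor
  · rintro ⟨a, b, c⟩ hp
    have ha : a ≠ 0 := fst_ne_zero_of_mem_sphereD hp
    have hd : 50 - 75 * (10 * a / (15 * a) - 1 / (25 * a)) = 3 / a := by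
      field_simp
      ring
    simp only [Ψ₁, Ψ₁Inv, hd, Prod.mk.injEq]
    refine ⟨?_, ?_, ?_⟩ <;> field_simp <;> ring
  · rintro ⟨a, b, c⟩ hp
    have ha : 50 - 75 * a ≠ 0 := denom_ne_zero_of_mem_sphereD hp
    simp only [Ψ₁, Ψ₁Inv, Prod.mk.injEq]
    refine ⟨?_, ?_, ?_⟩ <;> rw [← sub_eq_zero] <;> field_simp <;> ring

lemma continuousOn_Ψ₁ : ContinuousOn Ψ₁ sphereD := by
  have h15 : ∀ p ∈ sphereD, 15 * p.1 ≠ 0 := fun p hp =>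
    mul_ne_zero (by norm_num) (fst_ne_zero_of_mem_sphereD hp)
  have h25 : ∀ p ∈ sphereD, 25 * p.1 ≠ 0 := fun p hp =>
    mul_ne_zero (by norm_num) (fst_ne_zero_of_mem_sphereD hp)
  unfold Ψ₁
  fun_prop (disch := assumption)

lemma continuousOn_Ψ₁Inv : ContinuousOn Ψ₁Inv sphereD := by
  have h : ∀ p ∈ sphereD, 50 - 75 * p.1 ≠ 0 := fun p hp => denom_ne_zero_of_mem_sphereD hp
  unfold Ψ₁Inv
  fun_prop (disch := assumption)

/-- `Ψ₁` as a self-homeomorphism of `∂𝔻`. -/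
noncomputable def homeomorphΨ₁ : sphereD ≃ₜ sphereD where
  toFun := mapsTo_Ψ₁.restrict
  invFun := mapsTo_Ψ₁Inv.restrict
  left_inv x := Subtype.ext (invOn_Ψ₁Inv.1 x.2)
  right_inv x := Subtype.ext (invOn_Ψ₁Inv.2 x.2)
  continuous_toFun := continuousOn_Ψ₁.mapsToRestrict mapsTo_Ψ₁
  continuous_invFun := continuousOn_Ψ₁Inv.mapsToRestrict mapsTo_Ψ₁Inv

/-- The restriction of `Ψ₁` to `∂𝔻` is a homeomorphism from `∂𝔻` onto itself:
it is continuous and a bijection of `∂𝔻` onto itself. -/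
theorem stmt_10 :
    (ContinuousOn Ψ₁ sphereD ∧ Set.BijOn Ψ₁ sphereD sphereD) ∧
    ∃ e : sphereD ≃ₜ sphereD, ∀ x : sphereD, (e x : ℝ × ℝ × ℝ) = Ψ₁ x := by
  exact ⟨⟨continuousOn_Ψ₁, invOn_Ψ₁Inv.bijOn mapsTo_Ψ₁ mapsTo_Ψ₁Inv⟩,
    homeomorphΨ₁, fun _ => rfl⟩
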